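/- arXiv:1903.06416 — 3 statements merged into one kernel-verified Lean document; each statement's English description precedes it below -/
import Mathlib

section
/- Assume ω is nondegenerate. Then the tangent space to the coadjoint orbit of h through C, namely the image of the linear map h → h* sending v to the functional w ↦ -C(⁅v,w⁆_h), has dimension equal to dim g. -/
/-- If `ω` is nondegenerate, the tangent space to the coadjoint orbit of
`h = g ⊕ ℝ` through `C`, i.e. the image of the linear map `h → h*`, `v ↦ (w ↦ -C(⁅v,w⁆))`,
has dimension `dim g`. -/
theorem coadjoint_orbit_dim (g : Type*) [LieRing g] [LieAlgebra ℝ g] [FiniteDimensional ℝ g]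
    (ω : g →ₗ[ℝ] g →ₗ[ℝ] ℝ) (halt : ∀ X : g, ω X X = 0)
    (hcocycle : ∀ X Y Z : g, ω ⁅X, Y⁆ Z + ω ⁅Y, Z⁆ X + ω ⁅Z, X⁆ Y = 0)
    (hnondeg : ∀ X : g, (∀ Y : g, ω X Y = 0) → X = 0)
    (br : (g × ℝ) → (g × ℝ) → (g × ℝ))
    (hbr : ∀ v w : g × ℝ, br v w = (⁅v.1, w.1⁆, -ω v.1 w.1))
    (C : (g × ℝ) →ₗ[ℝ] ℝ) (hC : ∀ v : g × ℝ, C v = v.2)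
    (T : (g × ℝ) →ₗ[ℝ] Module.Dual ℝ (g × ℝ))
    (hT : ∀ v w : g × ℝ, T v w = -C (br v w)) :
    Module.finrank ℝ (LinearMap.range T) = Module.finrank ℝ g := by
  have hTω : ∀ v w : g × ℝ, T v w = ω v.1 w.1 := by
    intro v w
    rw [hT, hC, hbr, neg_neg]
  have hinj : Function.Injective (T.comp (LinearMap.inl ℝ g ℝ)) := by
    rw [injective_iff_map_eq_zero]
    intro X hX
    apply hnondeg
    intro Y
    have h := hTω (X, 0) (Y, 0)
    have h2 : T (X, 0) = 0 := hX
    rw [h2] at h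
    exact h.symm
  have hrange : LinearMap.range T = LinearMap.range (T.comp (LinearMap.inl ℝ g ℝ)) := by
    apply le_antisymm
    · rintro _ ⟨v, rfl⟩
      refine ⟨v.1, ?_⟩
      refine LinearMap.ext fun w => ?_
      change T (v.1, 0) w = T v w
      rw [hTω, hTω]
    · exact LinearMap.range_comp_le_range _ _
  rw [hrange]
  exact LinearMap.finrank_range_of_inj hinj
end

section
/- Let E be a finite-dimensional real normed vector space, ℓ : E → ℝ a nonzero continuous linear functional, and f : E → ℝ a smooth (C^∞) function that vanishes on the affine hyperplane D = {x ∈ E : ℓ(x) = 1}. Then there exists a smooth function g : E → ℝ such that f(x) = (ℓ(x) - 1) · g(x) for all x ∈ E. -/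
open MeasureTheory in
theorem hasFDerivAt_param_aux {E G : Type*} [NormedAddCommGroup E]
    [NormedSpace ℝ E] [FiniteDimensional ℝ E] [NormedAddCommGroup G] [NormedSpace ℝ G]
    (F : E × ℝ → G) (hF : ContDiff ℝ (⊤ : ℕ∞) F) (x₀ : E) :
    HasFDerivAt (fun x => ∫ t in (0:ℝ)..1, F (x, t))
      (∫ t in (0:ℝ)..1, (fderiv ℝ F (x₀, t)).comp (ContinuousLinearMap.inl ℝ E ℝ)) x₀ := by
  have hF' : Continuous (fun p : E × ℝ =>
      (fderiv ℝ F p).comp (ContinuousLinearMap.inl ℝ E ℝ)) :=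
    (hF.continuous_fderiv (by simp)).clm_comp continuous_const
  have hc := hF.continuous
  have : ProperSpace E := FiniteDimensional.proper ℝ E
  obtain ⟨C, hC⟩ := ((isCompact_closedBall x₀ 1).prod
    (isCompact_Icc (a := (0:ℝ)) (b := 1))).exists_bound_of_continuousOn hF'.continuousOn
  refine intervalIntegral.hasFDerivAt_integral_of_dominated_of_fderiv_le
    (F := fun x t => F (x, t))
    (F' := fun x t => (fderiv ℝ F (x, t)).comp (ContinuousLinearMap.inl ℝ E ℝ))
    (bound := fun _ => C) (s := Metric.closedBall x₀ 1)
    (Metric.closedBall_mem_nhds x₀ one_pos) ?_ ?_ ?_ ?_ ?_ ?_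
  · exact Filter.Eventually.of_forall fun x =>
      (hc.comp (by fun_prop : Continuous fun t : ℝ => (x, t))).aestronglyMeasurable
  · exact (hc.comp (by fun_prop : Continuous fun t : ℝ => (x₀, t))).intervalIntegrable _ _
  · exact (hF'.comp (by fun_prop : Continuous fun t : ℝ => (x₀, t))).aestronglyMeasurable
  · refine Filter.Eventually.of_forall fun t ht x hx => hC (x, t) ⟨hx, ?_⟩
    rw [Set.uIoc_of_le zero_le_one] at ht
    exact ⟨ht.1.le, ht.2⟩
  · exact intervalIntegrable_const
  · refine Filter.Eventually.of_forall fun t _ x _ => ?_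
    have h1 := (hF.differentiable (by simp) (x, t)).hasFDerivAt
    exact h1.comp x (hasFDerivAt_prodMk_left x t)

theorem contDiff_param_aux {E : Type u} [NormedAddCommGroup E]
    [NormedSpace ℝ E] [FiniteDimensional ℝ E] (n : ℕ) :
    ∀ (G : Type u) [NormedAddCommGroup G] [NormedSpace ℝ G]
    (F : E × ℝ → G) (_ : ContDiff ℝ (⊤ : ℕ∞) F),
    ContDiff ℝ n (fun x => ∫ t in (0:ℝ)..1, F (x, t)) := by
  induction n with
  | zero =>
    intro G _ _ F hF
    have : Differentiable ℝ (fun x => ∫ t in (0:ℝ)..1, F (x, t)) :=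
      fun x => (hasFDerivAt_param_aux F hF x).differentiableAt
    exact_mod_cast contDiff_zero.2 this.continuous
  | succ n ih =>
    intro G _ _ F hF
    have := (contDiff_succ_iff_hasFDerivAt (𝕜 := ℝ) (n := n)
      (f := fun x => ∫ t in (0:ℝ)..1, F (x, t))).2
      ⟨_, ih (E →L[ℝ] G) (fun p => (fderiv ℝ F p).comp (ContinuousLinearMap.inl ℝ E ℝ))
        ((hF.fderiv_right (m := (⊤ : ℕ∞)) (by simp)).clm_comp contDiff_const),
        fun x => hasFDerivAt_param_aux F hF x⟩
    exact_mod_cast this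

/-- Let `E` be a finite-dimensional real normed vector space,
`ℓ : E → ℝ` a nonzero continuous linear functional, and `f : E → ℝ` a smooth function
vanishing on the affine hyperplane `D = {x : ℓ x = 1}`. Then there exists a smooth
`g : E → ℝ` with `f x = (ℓ x - 1) * g x` for all `x`. -/
theorem smooth_factor_through_hyperplane (E : Type*) [NormedAddCommGroup E]
    [NormedSpace ℝ E] [FiniteDimensional ℝ E]
    (ℓ : E →L[ℝ] ℝ) (hℓ : ℓ ≠ 0)
    (f : E → ℝ) (hf : ContDiff ℝ (⊤ : ℕ∞) f)
    (hvanish : ∀ x : E, ℓ x = 1 → f x = 0) :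
    ∃ g : E → ℝ, ContDiff ℝ (⊤ : ℕ∞) g ∧ ∀ x : E, f x = (ℓ x - 1) * g x := by
  obtain ⟨v, hv⟩ : ∃ v, ℓ v = 1 := by
    obtain ⟨w, hw⟩ : ∃ w, ℓ w ≠ 0 := by
      by_contra! h
      exact hℓ (ContinuousLinearMap.ext h)
    exact ⟨(ℓ w)⁻¹ • w, by simp [hw]⟩
  have hfd : ContDiff ℝ (⊤ : ℕ∞) (fderiv ℝ f) := hf.fderiv_right (m := (⊤ : ℕ∞)) (by simp)
  have hF : ContDiff ℝ (⊤ : ℕ∞)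
      (fun p : E × ℝ => fderiv ℝ f (p.1 + ((p.2 - 1) * (ℓ p.1 - 1)) • v)) :=
    hfd.comp (by fun_prop)
  refine ⟨fun x => (∫ t in (0:ℝ)..1, fderiv ℝ f (x + ((t - 1) * (ℓ x - 1)) • v)) v, ?_, ?_⟩
  · refine ContDiff.clm_apply ?_ contDiff_const
    exact contDiff_infty.2 fun n => contDiff_param_aux n (E →L[ℝ] ℝ) _ hF
  · intro x
    have hcont : Continuous fun t : ℝ => fderiv ℝ f (x + ((t - 1) * (ℓ x - 1)) • v) :=
      hfd.continuous.comp (by fun_prop)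
    have hderiv : ∀ t : ℝ, HasDerivAt (fun t : ℝ => f (x + ((t - 1) * (ℓ x - 1)) • v))
        (fderiv ℝ f (x + ((t - 1) * (ℓ x - 1)) • v) ((ℓ x - 1) • v)) t := by
      intro t
      have h1 : HasDerivAt (fun t : ℝ => x + ((t - 1) * (ℓ x - 1)) • v) ((ℓ x - 1) • v) t := by
        have := ((((hasDerivAt_id t).sub_const 1).mul_const (ℓ x - 1)).smul_const v).const_add x
        simpa using this
      exact (hf.differentiable (by simp) _).hasFDerivAt.comp_hasDerivAt t h1
    have hint := intervalIntegral.integral_eq_sub_of_hasDerivAt (a := 0) (b := 1)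
      (fun t _ => hderiv t) ((hcont.clm_apply continuous_const).intervalIntegrable _ _)
    have h0 : f (x + (((0:ℝ) - 1) * (ℓ x - 1)) • v) = 0 := hvanish _ (by simp [hv])
    rw [h0] at hint
    rw [← ContinuousLinearMap.intervalIntegral_apply (hcont.intervalIntegrable _ _)] at hint
    simpa using hint.symm
end

section
/- Let g be a finite-dimensional real Lie algebra and ω : g × g → ℝ a nondegenerate alternating bilinear form, with inverse r : g* → g characterized by ω(r(α), Y) = α(Y) for all α ∈ g*, Y ∈ g. Then ω is a Chevalley–Eilenberg 2-cocycle, i.e. ω(⁅X,Y⁆,Z) + ω(⁅Y,Z⁆,X) + ω(⁅Z,X⁆,Y) = 0 for all X,Y,Z ∈ g, if and only if r satisfies the classical Yang–Baxter–type identity α(⁅r(β), r(γ)⁆) + β(⁅r(γ), r(α)⁆) + γ(⁅r(α), r(β)⁆) = 0 for all α, β, γ ∈ g* (i.e. the bivector r = ω^{-1} is an r-matrix). -/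
/-- Let `g` be a finite-dimensional real Lie algebra and `ω` a
nondegenerate alternating bilinear form with inverse `r : g* → g` characterized by
`ω (r α) Y = α Y`. Then `ω` is a Chevalley–Eilenberg 2-cocycle if and only if `r`
satisfies the classical Yang–Baxter-type identity, i.e. `r = ω⁻¹` is an r-matrix. -/
theorem cocycle_iff_rmatrix (g : Type*) [LieRing g] [LieAlgebra ℝ g]
    [FiniteDimensional ℝ g]
    (ω : g →ₗ[ℝ] g →ₗ[ℝ] ℝ) (halt : ∀ X : g, ω X X = 0)
    (hbij : Function.Bijective ω)
    (r : Module.Dual ℝ g →ₗ[ℝ] g)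
    (hr : ∀ (α : Module.Dual ℝ g) (Y : g), ω (r α) Y = α Y) :
    (∀ X Y Z : g, ω ⁅X, Y⁆ Z + ω ⁅Y, Z⁆ X + ω ⁅Z, X⁆ Y = 0) ↔
      (∀ α β γ : Module.Dual ℝ g,
        α ⁅r β, r γ⁆ + β ⁅r γ, r α⁆ + γ ⁅r α, r β⁆ = 0) := by
  have hsk : ∀ X Y : g, ω X Y = - ω Y X := by
    intro X Y
    have h := halt (X + Y)
    simp only [map_add, LinearMap.add_apply, halt] at h
    linarith
  have hrω : ∀ X : g, r (ω X) = X := by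
    intro X
    apply hbij.1
    ext Y
    exact hr (ω X) Y
  constructor
  · intro h α β γ
    have h1 := h (r α) (r β) (r γ)
    rw [hsk _ (r γ), hsk _ (r α), hsk _ (r β), hr, hr, hr] at h1
    linarith
  · intro h X Y Z
    have h1 := h (ω X) (ω Y) (ω Z)
    rw [hrω, hrω, hrω] at h1
    rw [hsk _ Z, hsk _ X, hsk _ Y]
    linarith
end
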